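/- arXiv:1703.05655 — 5 statements merged into one kernel-verified Lean document; each statement's English description precedes it below -/
import Mathlib

section
/- Let T be a rooted chain complete tree satisfying condition (*), endowed with the coarse wedge topology, let A ∈ 𝒜(T), and let D = {t ∈ T : cf(t) ≤ ω}. Then the map r_A : T → T defined by r_A(t) = max(t̂ ∩ cl(A) ∩ D) is well-defined and is a continuous retraction of T onto cl(A) ∩ D. -/
open Cardinal Ordinal Filter Set Topology

universe u v

section TreeDefs

variable {T : Type u} [PartialOrder T]

/-- `T` is a tree: the set of strict predecessors of every point is well-ordered by `<`. -/
def IsTreeOrder (T : Type u) [PartialOrder T] : Prop :=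
  ∀ x : T, IsWellOrder {y : T // y < x} (· < ·)

/-- Every chain has a supremum. -/
def ChainComplete (T : Type u) [PartialOrder T] : Prop :=
  ∀ c : Set T, IsChain (· ≤ ·) c → ∃ s, IsLUB c s

open Classical in
/-- The height `ht(x,T)` of `x`: the order type of the set of its strict predecessors. -/
noncomputable def htx (x : T) : Ordinal.{u} :=
  if h : IsWellOrder {y : T // y < x} (· < ·) then @Ordinal.type {y : T // y < x} (· < ·) h
  else 0

/-- The cofinality `cf(x)` of `ht(x,T)`. -/
noncomputable def cfx (x : T) : Cardinal.{u} := (htx x).cof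

/-- `x` lies on a successor level. -/
def SuccLevel (x : T) : Prop := ∃ β : Ordinal, htx x = β + 1

/-- The set of immediate successors of `x`. -/
def ims (x : T) : Set T := {y | x < y ∧ htx y = htx x + 1}

/-- The wedge `V_t = {s : t ≤ s}`. -/
def Vset (t : T) : Set T := {s | t ≤ s}

/-- Condition (*): every `t` with `cf(t) ≥ ω₁` has finitely many immediate successors. -/
def StarCond (T : Type u) [PartialOrder T] : Prop :=
  ∀ t : T, Cardinal.aleph 1 ≤ cfx t → (ims t).Finite

/-- The coarse wedge topology: generated by the sets `V_t` and their complements,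
for `t` minimal or on a successor level. -/
def coarseWedge (T : Type u) [PartialOrder T] : TopologicalSpace T :=
  TopologicalSpace.generateFrom
    {U : Set T | ∃ t : T, (IsMin t ∨ SuccLevel t) ∧ (U = Vset t ∨ U = (Vset t)ᶜ)}

open Classical in
/-- `s ∧ t = max (ŝ ∩ t̂)`, the largest common predecessor (when it exists). -/
noncomputable def wedge (s t : T) : T :=
  if h : ∃ m, IsGreatest {r : T | r ≤ s ∧ r ≤ t} m then h.choose else s

open Classical in
/-- `ψ(t) = ims(t)` if `cf(t) ≥ ω₁`, and `ψ(t) = {0}` (the root) otherwise. -/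
noncomputable def psiSet (root : T) (t : T) : Set T :=
  if Cardinal.aleph 1 ≤ cfx t then ims t else {root}

/-- `φ` is a choice function assigning to every `t` with `cf(t) = ω` a sequence of
successor-level elements strictly below `t` converging to `t`, and the constant
sequence at the root otherwise. -/
def PhiSpec [TopologicalSpace T] (root : T) (φ : T → ℕ → T) : Prop :=
  ∀ t : T,
    (cfx t ≠ Cardinal.aleph0 → ∀ n, φ t n = root) ∧
    (cfx t = Cardinal.aleph0 →
      (∀ n, φ t n < t ∧ SuccLevel (φ t n)) ∧ Tendsto (φ t) atTop (nhds t))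

/-- Membership in the family `𝒜(T)`: countable subsets containing the root, closed
under `∧`, `φ` and `ψ`. -/
structure Admissible (root : T) (φ : T → ℕ → T) (A : Set T) : Prop where
  countable : A.Countable
  root_mem : root ∈ A
  wedge_mem : ∀ s ∈ A, ∀ t ∈ A, wedge s t ∈ A
  phi_mem : ∀ t ∈ A, ∀ n, φ t n ∈ A
  psi_mem : ∀ t ∈ A, psiSet root t ⊆ A

/-- The height of the tree `T`: the least `α` such that the level `α` of `T` is empty. -/
noncomputable def treeHeight (T : Type u) [PartialOrder T] : Ordinal.{u} :=
  sInf {α : Ordinal | ∀ x : T, htx x ≠ α}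

end TreeDefs

/-- A retractional skeleton on a compact space `K`: a family of continuous retractions
with metrizable compact ranges, indexed by an up-directed partially ordered set,
commuting under the order, continuous under countable increasing suprema, and
converging pointwise to the identity. -/
structure RetractionalSkeleton (K : Type v) [TopologicalSpace K] where
  Γ : Type v
  [po : PartialOrder Γ]
  [ne : Nonempty Γ]
  directed : ∀ s t : Γ, ∃ u, s ≤ u ∧ t ≤ u
  r : Γ → K → K
  cont : ∀ s, Continuous (r s)
  retraction : ∀ s x, r s (r s x) = r s x
  compact_range : ∀ s, IsCompact (Set.range (r s))
  metrizable_range : ∀ s, TopologicalSpace.MetrizableSpace (Set.range (r s))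
  comm : ∀ s t : Γ, s ≤ t → ∀ x, r s (r t x) = r s x ∧ r t (r s x) = r s x
  seq_sup : ∀ s : ℕ → Γ, Monotone s → ∃ t : Γ, IsLUB (Set.range s) t ∧
      ∀ x, Tendsto (fun n => r (s n) x) atTop (nhds (r t x))
  net_conv : ∀ x : K, Tendsto (fun s : Γ => r s x) atTop (nhds x)

/-- The subset induced by a retractional skeleton: `D = ⋃ₛ rₛ[K]`. -/
def RetractionalSkeleton.inducedSet {K : Type v} [TopologicalSpace K]
    (R : RetractionalSkeleton K) : Set K :=
  ⋃ s : R.Γ, Set.range (R.r s)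

/-- `A` is a `Σ`-subset of `K`: for some homeomorphic injection `h` of `K` into a cube
`[0,1]^Γ`, `h(A) = h(K) ∩ Σ(Γ)`. -/
def IsSigmaSubset {K : Type v} [TopologicalSpace K] (A : Set K) : Prop :=
  ∃ (Γ : Type v) (h : K → Γ → Set.Icc (0 : ℝ) 1),
    Topology.IsEmbedding h ∧
      h '' A = Set.range h ∩ {x | {γ | (x γ : ℝ) ≠ 0}.Countable}

/-- `K` is a Valdivia compact space: it has a dense `Σ`-subset. -/
def IsValdivia (K : Type v) [TopologicalSpace K] : Prop :=
  ∃ A : Set K, Dense A ∧ IsSigmaSubset A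

/-- The bounded topology on a product `∏_{α<ω₁} X_α`: basic open sets are the sets
`V(g,β) = {f : f↾β = g↾β}` for `β < ω₁`. -/
def boundedTopology (X : Set.Iio (Cardinal.aleph 1).ord → Type v) :
    TopologicalSpace (∀ α, X α) :=
  TopologicalSpace.generateFrom
    {U | ∃ (g : ∀ α, X α) (β : Ordinal), β < (Cardinal.aleph 1).ord ∧
      U = {f | ∀ α : Set.Iio (Cardinal.aleph 1).ord, (α : Ordinal) < β → f α = g α}}

section TreeOrder

variable {T : Type u} [PartialOrder T]

lemma htx_eq_type (htree : IsTreeOrder T) (x : T) :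
    htx x = @Ordinal.type {y : T // y < x} (· < ·) (htree x) :=
  dif_pos (htree x)

lemma htx_eq_typein (htree : IsTreeOrder T) (x : T) (y : {y : T // y < x}) :
    htx y.1 = @Ordinal.typein {y : T // y < x} (· < ·) (htree x) y := by
  have := htree x
  have := htree y.1
  rw [htx_eq_type htree, ← Ordinal.type_subrel]
  refine Ordinal.type_eq.2 ⟨⟨⟨fun z => ⟨⟨z.1, z.2.trans y.2⟩, z.2⟩, fun z => ⟨z.1.1, z.2⟩,
    fun z => rfl, fun z => rfl⟩, ?_⟩⟩
  intro a b
  rfl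

lemma htx_lt_htx (htree : IsTreeOrder T) {x y : T} (h : y < x) : htx y < htx x := by
  have := htree x
  rw [htx_eq_typein htree x ⟨y, h⟩, htx_eq_type htree x]
  exact Ordinal.typein_lt_type _ _

lemma exists_lt_htx_eq (htree : IsTreeOrder T) {x : T} {β : Ordinal.{u}} (h : β < htx x) :
    ∃ y < x, htx y = β := by
  have := htree x
  rw [htx_eq_type htree x] at h
  obtain ⟨y, hy⟩ := Ordinal.typein_surj _ h
  exact ⟨y.1, y.2, (htx_eq_typein htree x y).trans hy⟩

lemma IsTreeOrder.le_or_lt_of_le (htree : IsTreeOrder T) {x y z : T} (hy : y ≤ x) (hz : z ≤ x) :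
    y ≤ z ∨ z < y := by
  rcases hy.eq_or_lt with rfl | hy'
  · exact hz.eq_or_lt.imp (fun h => h.ge) id
  rcases hz.eq_or_lt with rfl | hz'
  · exact Or.inl hy
  have := htree x
  rcases trichotomous_of (· < ·) (⟨y, hy'⟩ : {y : T // y < x}) ⟨z, hz'⟩ with h | h | h
  · exact Or.inl (le_of_lt h)
  · exact Or.inl (congrArg Subtype.val h).le
  · exact Or.inr h

lemma IsTreeOrder.isChain_of_bddAbove (htree : IsTreeOrder T) {c : Set T} {x : T}
    (hc : ∀ y ∈ c, y ≤ x) : IsChain (· ≤ ·) c := fun y hy z hz _ =>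
  (htree.le_or_lt_of_le (hc y hy) (hc z hz)).imp id le_of_lt

lemma exists_mem_ims_le (htree : IsTreeOrder T) {x y : T} (h : x < y) : ∃ z ∈ ims x, z ≤ y := by
  have hxy : htx x + 1 ≤ htx y := Order.add_one_le_of_lt (htx_lt_htx htree h)
  obtain ⟨z, hzy, hz⟩ : ∃ z ≤ y, htx z = htx x + 1 := by
    rcases hxy.eq_or_lt with he | hlt
    · exact ⟨y, le_rfl, he.symm⟩
    · obtain ⟨z, hz, he⟩ := exists_lt_htx_eq htree hlt
      exact ⟨z, hz.le, he⟩
  have hlt : htx x < htx z := hz ▸ Order.lt_add_one_iff.2 le_rfl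
  refine ⟨z, ⟨?_, hz⟩, hzy⟩
  rcases htree.le_or_lt_of_le h.le hzy with hle | hgt
  · exact hle.lt_of_ne fun he => hlt.ne (congrArg htx he)
  · exact absurd (htx_lt_htx htree hgt) hlt.not_gt

lemma succLevel_of_mem_ims {x y : T} (h : y ∈ ims x) : SuccLevel y := ⟨htx x, h.2⟩

lemma SuccLevel.cfx_le {x : T} (h : SuccLevel x) : cfx x ≤ ℵ₀ := by
  obtain ⟨β, hβ⟩ := h
  rw [cfx, hβ, Ordinal.cof_add_one]
  exact Cardinal.one_le_aleph0

lemma SuccLevel.exists_pred (htree : IsTreeOrder T) {x : T} (h : SuccLevel x) :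
    ∃ y < x, ∀ z < x, z ≤ y := by
  obtain ⟨β, hβ⟩ := h
  obtain ⟨y, hy, rfl⟩ := exists_lt_htx_eq htree (hβ ▸ Order.lt_add_one_iff.2 le_rfl : β < htx x)
  refine ⟨y, hy, fun z hz => (htree.le_or_lt_of_le hz.le hy.le).resolve_right fun hyz => ?_⟩
  have h1 := htx_lt_htx htree hyz
  have h2 := htx_lt_htx htree hz
  rw [hβ, Order.lt_add_one_iff] at h2
  exact h1.not_ge h2

lemma isMin_or_succLevel_or_aleph0_le (htree : IsTreeOrder T) (x : T) :
    IsMin x ∨ SuccLevel x ∨ ℵ₀ ≤ cfx x := by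
  rcases Ordinal.zero_or_succ_or_isSuccLimit (htx x) with h | ⟨β, h⟩ | h
  · refine Or.inl fun y hy => ?_
    by_contra hxy
    have := htx_lt_htx htree (lt_of_le_not_ge hy hxy)
    rw [h] at this
    exact not_lt_bot this
  · exact Or.inr (Or.inl ⟨β, h.symm⟩)
  · exact Or.inr (Or.inr (Ordinal.aleph0_le_cof_iff.2 (Ordinal.one_lt_cof_iff.2 h)))

lemma IsMin.cfx_le (htree : IsTreeOrder T) {x : T} (h : IsMin x) : cfx x ≤ ℵ₀ := by
  have : htx x = 0 := by
    by_contra h0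
    obtain ⟨y, hy, -⟩ := exists_lt_htx_eq htree (pos_iff_ne_zero.2 h0)
    exact hy.not_ge (h hy.le)
  rw [cfx, this, Ordinal.cof_zero]
  exact zero_le

lemma cfx_le_aleph0_of_countable_cofinal (htree : IsTreeOrder T) {x : T} {B : Set T}
    (hB : B.Countable) (hlt : ∀ b ∈ B, b < x) (hcof : ∀ y < x, ∃ b ∈ B, y ≤ b) :
    cfx x ≤ ℵ₀ := by
  by_contra! hx
  have hcard : Cardinal.mk B < (htx x).cof := (Cardinal.mk_le_aleph0_iff.2 hB.to_subtype).trans_lt hx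
  have hsup := Ordinal.iSup_add_one_lt_of_lt_cof (f := fun b : B => htx b.1) hcard
    fun b => htx_lt_htx htree (hlt b b.2)
  obtain ⟨y, hyx, hy⟩ := exists_lt_htx_eq htree hsup
  obtain ⟨b, hb, hyb⟩ := hcof y hyx
  have h1 : htx b + 1 ≤ htx y := hy ▸ Ordinal.le_iSup (fun b : B => htx b.1 + 1) ⟨b, hb⟩
  have h2 : htx b < htx y := Order.add_one_le_iff.1 h1
  rcases hyb.eq_or_lt with rfl | h
  · exact h2.false
  · exact h2.not_gt (htx_lt_htx htree h)

lemma exists_succLevel_between (htree : IsTreeOrder T) {x y : T} (hx : ¬ SuccLevel x)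
    (h : y < x) : ∃ t, SuccLevel t ∧ y < t ∧ t < x := by
  obtain ⟨t, ht, htx⟩ := exists_mem_ims_le htree h
  have hs := succLevel_of_mem_ims ht
  exact ⟨t, hs, ht.1, htx.lt_of_ne fun he => hx (he ▸ hs)⟩

lemma isGreatest_wedge (htree : IsTreeOrder T) (hcc : ChainComplete T) (s t : T) :
    IsGreatest {r : T | r ≤ s ∧ r ≤ t} (wedge s t) := by
  have h : ∃ m, IsGreatest {r : T | r ≤ s ∧ r ≤ t} m := by
    obtain ⟨m, hm⟩ := hcc {r : T | r ≤ s ∧ r ≤ t} (htree.isChain_of_bddAbove fun y hy => hy.1)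
    exact ⟨m, ⟨hm.2 fun y hy => hy.1, hm.2 fun y hy => hy.2⟩, hm.1⟩
  rw [wedge, dif_pos h]
  exact h.choose_spec

/-- A wedge-closed set meets every `V_p` in a set with a least element. -/
lemma exists_isLeast_inter_Vset (htree : IsTreeOrder T) (hcc : ChainComplete T) {A : Set T}
    (hA : ∀ s ∈ A, ∀ t ∈ A, wedge s t ∈ A) {p : T} (h : (A ∩ Vset p).Nonempty) :
    ∃ q, IsLeast (A ∩ Vset p) q := by
  obtain ⟨q, hq, hmin⟩ := (InvImage.wf (htx (T := T)) Ordinal.lt_wf).has_min _ h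
  refine ⟨q, hq, fun a ha => ?_⟩
  have hw := isGreatest_wedge htree hcc q a
  rcases hw.1.1.eq_or_lt with he | hlt
  · exact he ▸ hw.1.2
  · exact absurd (htx_lt_htx htree hlt)
      (hmin _ ⟨hA q hq.1 a ha.1, hw.2 ⟨hq.2, ha.2⟩⟩)

lemma le_of_forall_succLevel_lt (htree : IsTreeOrder T) (hcc : ChainComplete T) {q s : T}
    (hq : ¬ SuccLevel q) (h : ∀ t < q, SuccLevel t → t ≤ s) : q ≤ s := by
  obtain ⟨l, hl⟩ := hcc {y | y < q} (htree.isChain_of_bddAbove fun y hy => le_of_lt hy)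
  have hlq : l ≤ q := hl.2 fun y hy => le_of_lt hy
  have hls : l ≤ s := by
    refine hl.2 fun y hy => ?_
    obtain ⟨t, ht, hyt, htq⟩ := exists_succLevel_between htree hq hy
    exact hyt.le.trans (h t htq ht)
  rcases hlq.eq_or_lt with rfl | hlt
  · exact hls
  · obtain ⟨t, -, hlt', htq⟩ := exists_succLevel_between htree hq hlt
    exact absurd (hl.1 htq) hlt'.not_ge

end TreeOrder

section CoarseWedge

variable {T : Type u} [PartialOrder T] [τ : TopologicalSpace T]

lemma isOpen_Vset (hτ : τ = coarseWedge T) {t : T} (ht : IsMin t ∨ SuccLevel t) :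
    IsOpen (Vset t) := by
  subst hτ
  exact TopologicalSpace.isOpen_generateFrom_of_mem ⟨t, ht, Or.inl rfl⟩

lemma isClosed_Vset_of_isMin_or_succLevel (hτ : τ = coarseWedge T) {t : T}
    (ht : IsMin t ∨ SuccLevel t) : IsClosed (Vset t) := by
  subst hτ
  let := coarseWedge T
  exact ⟨TopologicalSpace.isOpen_generateFrom_of_mem ⟨t, ht, Or.inr rfl⟩⟩

lemma isClopen_Vset (hτ : τ = coarseWedge T) {t : T} (ht : IsMin t ∨ SuccLevel t) :
    IsClopen (Vset t) :=
  ⟨isClosed_Vset_of_isMin_or_succLevel hτ ht, isOpen_Vset hτ ht⟩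

lemma isClosed_Vset (hτ : τ = coarseWedge T) (htree : IsTreeOrder T) (hcc : ChainComplete T)
    (q : T) : IsClosed (Vset q) := by
  by_cases hq : SuccLevel q
  · exact isClosed_Vset_of_isMin_or_succLevel hτ (Or.inr hq)
  have : Vset q = ⋂ t ∈ {t | t < q ∧ SuccLevel t}, Vset t := by
    ext s
    simp only [mem_iInter]
    exact ⟨fun h t ht => ht.1.le.trans h,
      fun h => le_of_forall_succLevel_lt htree hcc hq fun t h1 h2 => h t ⟨h1, h2⟩⟩
  rw [this]
  exact isClosed_biInter fun t ht => isClosed_Vset_of_isMin_or_succLevel hτ (Or.inr ht.2)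

/-- The supremum of a nonempty set lies in its closure. -/
lemma IsTreeOrder.mem_closure_of_isLUB (hτ : τ = coarseWedge T) (htree : IsTreeOrder T)
    {B : Set T} (hne : B.Nonempty) {m : T} (hm : IsLUB B m) : m ∈ closure B := by
  by_cases hmB : m ∈ B
  · exact subset_closure hmB
  have hlt : ∀ b ∈ B, b < m := fun b hb => (hm.1 hb).lt_of_ne fun he => hmB (he ▸ hb)
  have : Nonempty B := hne.to_subtype
  have : IsDirectedOrder B := ⟨fun a b => by
    rcases htree.le_or_lt_of_le (hm.1 a.2) (hm.1 b.2) with h | h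
    · exact ⟨b, h, le_rfl⟩
    · exact ⟨a, le_rfl, h.le⟩⟩
  have hlim : Tendsto (fun b : B => b.1) atTop (𝓝 m) := by
    subst hτ
    refine TopologicalSpace.tendsto_nhds_generateFrom_iff.2 ?_
    rintro U ⟨t, ht, rfl | rfl⟩ hmU
    · have htm : t < m := by
        refine lt_of_le_of_ne hmU ?_
        rintro rfl
        obtain ⟨b, hb⟩ := hne
        rcases ht with ht | ht
        · exact (hlt b hb).not_ge (ht (hlt b hb).le)
        · obtain ⟨y, hy, hy'⟩ := ht.exists_pred htree
          exact hy.not_ge (hm.2 fun b hb => hy' b (hlt b hb))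
      obtain ⟨b, hb, htb⟩ : ∃ b ∈ B, ¬ b ≤ t := by
        by_contra! h
        exact htm.not_ge (hm.2 h)
      have htb' : t ≤ b := ((htree.le_or_lt_of_le (hm.1 hb) htm.le).resolve_left htb).le
      filter_upwards [eventually_ge_atTop (⟨b, hb⟩ : B)] with c hc
      exact htb'.trans hc
    · exact Eventually.of_forall fun b htb => hmU (le_trans htb (hm.1 b.2))
  exact mem_closure_of_tendsto hlim (Eventually.of_forall fun b => b.2)

/-- A point in the closure of a wedge-closed set `A` but not in `A` is on a limit level and is
the supremum of the points of `A` strictly below it. -/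
lemma exists_mem_between_of_mem_closure (hτ : τ = coarseWedge T) (htree : IsTreeOrder T)
    (hcc : ChainComplete T) {A : Set T} (hA : ∀ s ∈ A, ∀ t ∈ A, wedge s t ∈ A) {u : T}
    (hu : u ∈ closure A) (huA : u ∉ A) {y : T} (hy : y < u) : ∃ a ∈ A, y < a ∧ a < u := by
  obtain ⟨W, hWo, huW, hW⟩ : ∃ W : Set T, IsOpen W ∧ u ∈ W ∧ ∀ a ∈ A, a ∈ W → ¬ u ≤ a := by
    by_cases hne : (A ∩ Vset u).Nonempty
    · obtain ⟨q, hq, hmin⟩ := exists_isLeast_inter_Vset htree hcc hA hne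
      have huq : u < q := lt_of_le_of_ne hq.2 fun he => huA (he ▸ hq.1)
      obtain ⟨s, hs, hsq⟩ := exists_mem_ims_le htree huq
      exact ⟨(Vset s)ᶜ,
        (isClosed_Vset_of_isMin_or_succLevel hτ (Or.inr (succLevel_of_mem_ims hs))).isOpen_compl,
        fun h => hs.1.not_ge h, fun a ha haW hua => haW (hsq.trans (hmin ⟨ha, hua⟩))⟩
    · exact ⟨univ, isOpen_univ, mem_univ u, fun a ha _ hua => hne ⟨a, ha, hua⟩⟩
  have hus : ¬ SuccLevel u := by
    intro hs
    obtain ⟨a, ⟨haW, hua⟩, ha⟩ := mem_closure_iff.1 hu _ (hWo.inter (isOpen_Vset hτ (Or.inr hs)))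
      ⟨huW, le_refl u⟩
    exact hW a ha haW hua
  have key : ∀ z < u, ∃ t a, z < t ∧ t < u ∧ a ∈ A ∧ t ≤ a ∧ ¬ u ≤ a := by
    intro z hz
    obtain ⟨t, ht, hzt, htu⟩ := exists_succLevel_between htree hus hz
    obtain ⟨a, ⟨haW, hta⟩, ha⟩ := mem_closure_iff.1 hu _ (hWo.inter (isOpen_Vset hτ (Or.inr ht)))
      ⟨huW, htu.le⟩
    exact ⟨t, a, hzt, htu, ha, hta, hW a ha haW⟩
  obtain ⟨t₁, a₁, hyt₁, ht₁u, ha₁, hta₁, hua₁⟩ := key y hy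
  have hw := isGreatest_wedge htree hcc a₁ u
  have hwu : wedge a₁ u < u := lt_of_le_of_ne hw.1.2 fun he => hua₁ (he ▸ hw.1.1)
  have ht₁w : t₁ ≤ wedge a₁ u := hw.2 ⟨hta₁, ht₁u.le⟩
  obtain ⟨t₂, a₂, hwt₂, ht₂u, ha₂, hta₂, -⟩ := key _ hwu
  have hr := isGreatest_wedge htree hcc a₁ a₂
  refine ⟨wedge a₁ a₂, hA _ ha₁ _ ha₂,
    hyt₁.trans_le (hr.2 ⟨hta₁, ht₁w.trans (hwt₂.le.trans hta₂)⟩), ?_⟩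
  rcases htree.le_or_lt_of_le hr.1.2 hta₂ with h | h
  · exact h.trans_lt ht₂u
  · exact absurd (hw.2 ⟨h.le.trans hr.1.1, ht₂u.le⟩) hwt₂.not_ge

end CoarseWedge

section Admissible

variable {T : Type u} [PartialOrder T] {root : T} {φ : T → ℕ → T} {A : Set T}

lemma Admissible.ims_subset (hA : Admissible root φ A) {t : T} (ht : t ∈ A)
    (hcf : ¬ cfx t ≤ ℵ₀) : ims t ⊆ A := by
  have := hA.psi_mem t ht
  rwa [psiSet, if_pos (aleph_one_le_iff.2 (not_le.1 hcf))] at this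

lemma Admissible.exists_isGreatest [τ : TopologicalSpace T] (hτ : τ = coarseWedge T)
    (htree : IsTreeOrder T) (hcc : ChainComplete T) (hroot : ∀ x : T, root ≤ x)
    (hA : Admissible root φ A) (t : T) :
    ∃ m : T, IsGreatest ({s : T | s ≤ t} ∩ closure A ∩ {u : T | cfx u ≤ ℵ₀}) m := by
  set B : Set T := {b | b ∈ A ∧ b ≤ t ∧ cfx b ≤ ℵ₀} with hB
  have hne : B.Nonempty :=
    ⟨root, hA.root_mem, hroot t, IsMin.cfx_le htree fun y _ => hroot y⟩
  obtain ⟨m, hm⟩ := hcc B (htree.isChain_of_bddAbove fun b hb => hb.2.1)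
  have hmt : m ≤ t := hm.2 fun b hb => hb.2.1
  refine ⟨m, ⟨⟨hmt, closure_mono (fun b hb => hb.1)
    (htree.mem_closure_of_isLUB hτ hne hm)⟩, ?_⟩, ?_⟩
  · by_cases hmB : m ∈ B
    · exact hmB.2.2
    refine cfx_le_aleph0_of_countable_cofinal htree (hA.countable.mono fun b hb => hb.1)
      (fun b hb => (hm.1 hb).lt_of_ne fun he => hmB (he ▸ hb)) fun y hy => ?_
    by_contra! h
    exact hy.not_ge (hm.2 fun b hb =>
      ((htree.le_or_lt_of_le hy.le (hm.1 hb)).resolve_left (h b hb)).le)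
  · rintro u ⟨⟨hut, hu⟩, hucf⟩
    by_cases huA : u ∈ A
    · exact hm.1 ⟨huA, hut, hucf⟩
    refine (htree.le_or_lt_of_le hut hmt).resolve_right fun hmu => ?_
    obtain ⟨a, ha, hma, hau⟩ :=
      exists_mem_between_of_mem_closure hτ htree hcc hA.wedge_mem hu huA hmu
    by_cases hacf : cfx a ≤ ℵ₀
    · exact hma.not_ge (hm.1 ⟨ha, hau.le.trans hut, hacf⟩)
    · obtain ⟨s, hs, hsu⟩ := exists_mem_ims_le htree hau
      exact (hma.trans hs.1).not_ge
        (hm.1 ⟨hA.ims_subset ha hacf hs, hsu.trans hut, (succLevel_of_mem_ims hs).cfx_le⟩)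

lemma Admissible.isClopen_preimage_Vset [τ : TopologicalSpace T] (hτ : τ = coarseWedge T)
    (htree : IsTreeOrder T) (hcc : ChainComplete T) (hstar : StarCond T) (hφ : PhiSpec root φ)
    (hA : Admissible root φ A) {r : T → T}
    (hr : ∀ t : T, IsGreatest ({s : T | s ≤ t} ∩ closure A ∩ {u : T | cfx u ≤ ℵ₀}) (r t))
    {p : T} (hp : IsMin p ∨ SuccLevel p) : IsClopen (r ⁻¹' Vset p) := by
  have hpo := isOpen_Vset hτ hp
  by_cases hne : (A ∩ Vset p).Nonempty
  swap
  · have : r ⁻¹' Vset p = ∅ := by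
      refine eq_empty_of_forall_notMem fun t ht => ?_
      obtain ⟨a, hap, ha⟩ := mem_closure_iff.1 (hr t).1.1.2 _ hpo ht
      exact hne ⟨a, ha, hap⟩
    rw [this]
    exact isClopen_empty
  obtain ⟨q, hq, hmin⟩ := exists_isLeast_inter_Vset htree hcc hA.wedge_mem hne
  have hqr : ∀ t, p ≤ r t → q ≤ r t := by
    intro t ht
    by_contra hqt
    obtain ⟨a, ⟨hap, haq⟩, ha⟩ := mem_closure_iff.1 (hr t).1.1.2 _
      (hpo.inter (isClosed_Vset hτ htree hcc q).isOpen_compl) ⟨ht, hqt⟩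
    exact haq (hmin ⟨ha, hap⟩)
  by_cases hcf : cfx q ≤ ℵ₀
  · have hpre : r ⁻¹' Vset p = Vset q := by
      ext t
      exact ⟨fun h => (hqr t h).trans (hr t).1.1.1,
        fun h => le_trans hq.2 ((hr t).2 ⟨⟨h, subset_closure hq.1⟩, hcf⟩)⟩
    rw [hpre]
    rcases isMin_or_succLevel_or_aleph0_le htree q with h | h | h
    · exact isClopen_Vset hτ (Or.inl h)
    · exact isClopen_Vset hτ (Or.inr h)
    · obtain ⟨hlt, hlim⟩ := (hφ q).2 (hcf.antisymm h)
      obtain ⟨n, hn⟩ := (hlim.eventually (hpo.mem_nhds hq.2)).exists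
      exact absurd (hmin ⟨hA.phi_mem q hq.1 n, hn⟩) (hlt n).1.not_ge
  · have hpre : r ⁻¹' Vset p = ⋃ s ∈ ims q, Vset s := by
      ext t
      simp only [mem_iUnion]
      constructor
      · intro h
        have hlt : q < r t := (hqr t h).lt_of_ne fun he => hcf (he ▸ (hr t).1.2)
        obtain ⟨s, hs, hst⟩ := exists_mem_ims_le htree hlt
        exact ⟨s, hs, hst.trans (hr t).1.1.1⟩
      · rintro ⟨s, hs, hst⟩
        exact (le_trans hq.2 hs.1.le).trans ((hr t).2
          ⟨⟨hst, subset_closure (hA.ims_subset hq.1 hcf hs)⟩, (succLevel_of_mem_ims hs).cfx_le⟩)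
    rw [hpre]
    exact (hstar q (aleph_one_le_iff.2 (not_le.1 hcf))).isClopen_biUnion fun s hs =>
      isClopen_Vset hτ (Or.inr (succLevel_of_mem_ims hs))

end Admissible

theorem stmt8 {T : Type u} [PartialOrder T] [τ : TopologicalSpace T]
    (hτ : τ = coarseWedge T) (htree : IsTreeOrder T) (hcc : ChainComplete T)
    (root : T) (hroot : ∀ x : T, root ≤ x)
    (hstar : StarCond T) (φ : T → ℕ → T) (hφ : PhiSpec root φ)
    (A : Set T) (hA : Admissible root φ A) :
    (∀ t : T, ∃ m : T, IsGreatest ({s : T | s ≤ t} ∩ closure A ∩ {u : T | cfx u ≤ Cardinal.aleph0}) m) ∧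
    (∀ rA : T → T, (∀ t : T, IsGreatest ({s : T | s ≤ t} ∩ closure A ∩ {u : T | cfx u ≤ Cardinal.aleph0}) (rA t)) →
      Continuous rA ∧ Set.range rA = closure A ∩ {u : T | cfx u ≤ Cardinal.aleph0} ∧
        ∀ t ∈ closure A ∩ {u : T | cfx u ≤ Cardinal.aleph0}, rA t = t) := by
  refine ⟨hA.exists_isGreatest hτ htree hcc hroot, fun r hr => ?_⟩
  have hfix : ∀ t ∈ closure A ∩ {u : T | cfx u ≤ Cardinal.aleph0}, r t = t := fun t ht =>
    (hr t).1.1.1.antisymm ((hr t).2 ⟨⟨le_refl t, ht.1⟩, ht.2⟩)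
  refine ⟨?_, ?_, hfix⟩
  · have hpre := fun {p : T} => hA.isClopen_preimage_Vset hτ htree hcc hstar hφ hr (p := p)
    have hcont : @Continuous T T τ (coarseWedge T) r := by
      refine continuous_generateFrom_iff.2 ?_
      rintro U ⟨p, hp, rfl | rfl⟩
      · exact (hpre hp).isOpen
      · exact (hpre hp).compl.isOpen
    rwa [← hτ] at hcont
  · exact Subset.antisymm (range_subset_iff.2 fun t => ⟨(hr t).1.1.2, (hr t).1.2⟩)
      fun t ht => ⟨t, hfix t ht⟩
end

section
/- Let T be a rooted chain complete tree satisfying condition (*), endowed with the coarse wedge topology, let D = {t ∈ T : cf(t) ≤ ω}, and for A ∈ 𝒜(T) let r_A(t) = max(t̂ ∩ cl(A) ∩ D). If A, B ∈ 𝒜(T) with A ⊆ B, then r_A = r_B ∘ r_A = r_A ∘ r_B. -/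
open Cardinal Ordinal Filter Set Topology

universe u v

theorem stmt10 {T : Type u} [PartialOrder T] [τ : TopologicalSpace T]
    (hτ : τ = coarseWedge T) (htree : IsTreeOrder T) (hcc : ChainComplete T)
    (root : T) (hroot : ∀ x : T, root ≤ x)
    (hstar : StarCond T) (φ : T → ℕ → T) (hφ : PhiSpec root φ)
    (A B : Set T) (hA : Admissible root φ A) (hB : Admissible root φ B) (hAB : A ⊆ B)
    (rA rB : T → T)
    (hrA : ∀ t : T, IsGreatest ({s : T | s ≤ t} ∩ closure A ∩ {u : T | cfx u ≤ Cardinal.aleph0}) (rA t))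
    (hrB : ∀ t : T, IsGreatest ({s : T | s ≤ t} ∩ closure B ∩ {u : T | cfx u ≤ Cardinal.aleph0}) (rB t)) :
    ∀ t : T, rB (rA t) = rA t ∧ rA (rB t) = rA t := by
  intro t
  obtain ⟨⟨⟨hAt, hAcl⟩, hAD⟩, hAmax⟩ := hrA t
  have hBcl : rA t ∈ closure B := closure_mono hAB hAcl
  have hAB_le : rA t ≤ rB t := (hrB t).2 ⟨⟨hAt, hBcl⟩, hAD⟩
  obtain ⟨⟨⟨hle, hcl⟩, hD⟩, hmax⟩ := hrA (rB t)
  exact ⟨le_antisymm (hrB (rA t)).1.1.1 ((hrB (rA t)).2 ⟨⟨le_rfl, hBcl⟩, hAD⟩),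
    le_antisymm (hAmax ⟨⟨le_trans hle (hrB t).1.1.1, hcl⟩, hD⟩)
      (hmax ⟨⟨hAB_le, hAcl⟩, hAD⟩)⟩
end

section
/- Let T be a rooted chain complete tree satisfying condition (*), endowed with the coarse wedge topology, let D = {t ∈ T : cf(t) ≤ ω}, and for A ∈ 𝒜(T) let r_A(t) = max(t̂ ∩ cl(A) ∩ D). Then for every t ∈ T, the net (r_A(t))_{A ∈ 𝒜(T)}, where 𝒜(T) is directed by inclusion, converges to t; that is, for every open neighborhood W of t there exists A ∈ 𝒜(T) such that r_B(t) ∈ W for every B ∈ 𝒜(T) with B ⊇ A. -/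
open Cardinal Ordinal Filter Set Topology

universe u v

section AdmissibleSets

variable {T : Type u} [PartialOrder T]

lemma psiSet_countable (hstar : StarCond T) (root t : T) : (psiSet root t).Countable := by
  unfold psiSet
  split_ifs with h
  · exact (hstar t h).countable
  · exact countable_singleton root

/-- One round of closing a set under `∧`, `φ` and `ψ`. -/
def admissibleStep (root : T) (φ : T → ℕ → T) (S : Set T) : Set T :=
  S ∪ (image2 wedge S S ∪ ⋃ t ∈ S, (range (φ t) ∪ psiSet root t))

lemma admissibleStep_countable (hstar : StarCond T) (root : T) (φ : T → ℕ → T) {S : Set T}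
    (hS : S.Countable) : (admissibleStep root φ S).Countable :=
  hS.union ((hS.image2 hS wedge).union
    (hS.biUnion fun t _ => (countable_range (φ t)).union (psiSet_countable hstar root t)))

/-- Every countable set is contained in an admissible set. -/
lemma exists_admissible_superset (hstar : StarCond T) (root : T) (φ : T → ℕ → T) {S : Set T}
    (hS : S.Countable) : ∃ A, Admissible root φ A ∧ S ⊆ A := by
  let F : ℕ → Set T := fun n => (admissibleStep root φ)^[n] (insert root S)
  have hsucc (n : ℕ) : F (n + 1) = admissibleStep root φ (F n) :=
    Function.iterate_succ_apply' _ _ _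
  have hmono : Monotone F := monotone_nat_of_le_succ fun n => by
    rw [hsucc]
    exact subset_union_left
  have hcount (n : ℕ) : (F n).Countable := by
    induction n with
    | zero => exact hS.insert root
    | succ n ih => rw [hsucc]; exact admissibleStep_countable hstar root φ ih
  have hF0 : insert root S ⊆ ⋃ n, F n := subset_iUnion F 0
  have hstep {n : ℕ} {x : T} (hx : x ∈ admissibleStep root φ (F n)) : x ∈ ⋃ n, F n :=
    mem_iUnion.2 ⟨n + 1, by rwa [hsucc]⟩
  refine ⟨⋃ n, F n, ⟨countable_iUnion hcount, hF0 (mem_insert _ _), ?_, ?_, ?_⟩,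
    (subset_insert _ _).trans hF0⟩
  · intro s hs t ht
    obtain ⟨m, hm⟩ := mem_iUnion.1 hs
    obtain ⟨n, hn⟩ := mem_iUnion.1 ht
    exact hstep (n := max m n) (Or.inr (Or.inl
      (mem_image2_of_mem (hmono (le_max_left m n) hm) (hmono (le_max_right m n) hn))))
  · intro t ht k
    obtain ⟨n, hn⟩ := mem_iUnion.1 ht
    exact hstep (n := n) (Or.inr (Or.inr (mem_biUnion hn (Or.inl (mem_range_self k)))))
  · intro t ht x hx
    obtain ⟨n, hn⟩ := mem_iUnion.1 ht
    exact hstep (n := n) (Or.inr (Or.inr (mem_biUnion hn (Or.inr hx))))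

lemma SuccLevel.cfx_le_aleph0 {s : T} (hs : SuccLevel s) : cfx s ≤ Cardinal.aleph0 := by
  obtain ⟨β, hβ⟩ := hs
  rw [cfx, hβ, Ordinal.cof_add_one]
  exact Cardinal.one_le_aleph0

end AdmissibleSets

theorem stmt12 {T : Type u} [PartialOrder T] [τ : TopologicalSpace T]
    (hτ : τ = coarseWedge T) (htree : IsTreeOrder T) (hcc : ChainComplete T)
    (root : T) (hroot : ∀ x : T, root ≤ x)
    (hstar : StarCond T) (φ : T → ℕ → T) (hφ : PhiSpec root φ) :
    ∀ t : T, ∀ W : Set T, IsOpen W → t ∈ W →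
      ∃ A : Set T, Admissible root φ A ∧
        ∀ B : Set T, Admissible root φ B → A ⊆ B →
          ∀ y : T, IsGreatest ({s : T | s ≤ t} ∩ closure B ∩ {u : T | cfx u ≤ Cardinal.aleph0}) y → y ∈ W := by
  intro t W hW
  rw [hτ] at hW
  induction hW with
  | basic U hU =>
    intro ht
    obtain ⟨s, hs, rfl | rfl⟩ := hU
    · obtain ⟨A, hA, hsA⟩ := exists_admissible_superset hstar root φ (countable_singleton s)
      refine ⟨A, hA, fun B _ hAB y hy => ?_⟩
      rcases hs with hs | hs
      · exact (hs (hroot s)).trans (hroot y)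
      · exact hy.2 ⟨⟨ht, subset_closure (hAB (hsA rfl))⟩, hs.cfx_le_aleph0⟩
    · obtain ⟨A, hA, -⟩ := exists_admissible_superset hstar root φ countable_empty
      exact ⟨A, hA, fun B _ _ y hy hsy => ht (le_trans hsy hy.1.1.1)⟩
  | univ =>
    intro _
    obtain ⟨A, hA, -⟩ := exists_admissible_superset hstar root φ countable_empty
    exact ⟨A, hA, fun _ _ _ y _ => mem_univ y⟩
  | inter U V _ _ ihU ihV =>
    intro ht
    obtain ⟨A₁, hA₁, h₁⟩ := ihU ht.1
    obtain ⟨A₂, hA₂, h₂⟩ := ihV ht.2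
    obtain ⟨A, hA, hsub⟩ :=
      exists_admissible_superset hstar root φ (hA₁.countable.union hA₂.countable)
    exact ⟨A, hA, fun B hB hAB y hy =>
      ⟨h₁ B hB ((subset_union_left.trans hsub).trans hAB) y hy,
        h₂ B hB ((subset_union_right.trans hsub).trans hAB) y hy⟩⟩
  | sUnion 𝒰 _ ih =>
    intro ht
    obtain ⟨U, hU, htU⟩ := ht
    obtain ⟨A, hA, h⟩ := ih U hU htU
    exact ⟨A, hA, fun B hB hAB y hy => ⟨U, hU, h B hB hAB y hy⟩⟩
end

section
/- Let X = ∏_{α<ω₁} X_α, where |X_α| ≥ 2 for every α < ω₁, endowed with the bounded topology. If {A_ξ}_{ξ<ω₁} is a family of open dense subsets of X, then ⋂_{ξ<ω₁} A_ξ is dense in X. -/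
open Cardinal Ordinal Filter Set Topology

universe u v

/-- Transfinite construction of a sequence that is pairwise related by `r`, from the
possibility of extending every initial segment. -/
theorem exists_seq_of_extend {ι : Type*} {P : Type*} [LinearOrder ι] [WellFoundedLT ι]
    [Nonempty P] (r : P → P → Prop) (good : ι → P → Prop)
    (h : ∀ (ξ : ι) (s : Iio ξ → P), (∀ η η', η < η' → r (s η) (s η')) →
      (∀ η : Iio ξ, good η (s η)) → ∃ t, (∀ η, r (s η) t) ∧ good ξ t) :
    ∃ F : ι → P, (∀ η ξ, η < ξ → r (F η) (F ξ)) ∧ ∀ ξ, good ξ (F ξ) := by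
  have h' : ∀ (ξ : ι) (s : Iio ξ → P), ∃ t, (∀ η η', η < η' → r (s η) (s η')) →
      (∀ η : Iio ξ, good η (s η)) → (∀ η, r (s η) t) ∧ good ξ t := by
    intro ξ s
    by_cases hs : (∀ η η', η < η' → r (s η) (s η')) ∧ ∀ η : Iio ξ, good η (s η)
    · obtain ⟨t, ht⟩ := h ξ s hs.1 hs.2
      exact ⟨t, fun _ _ => ht⟩
    · exact ⟨Classical.arbitrary P, fun h₁ h₂ => absurd ⟨h₁, h₂⟩ hs⟩
  choose ext hext using h'
  let F : ι → P := WellFoundedLT.fix fun ξ ih => ext ξ fun η => ih η η.2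
  have hF : ∀ ξ, F ξ = ext ξ fun η => F η := fun ξ => WellFoundedLT.fix_eq _ ξ
  have key : ∀ ξ, (∀ η, η < ξ → r (F η) (F ξ)) ∧ good ξ (F ξ) := by
    intro ξ
    induction ξ using WellFoundedLT.induction with
    | ind ξ ih =>
      obtain ⟨h₁, h₂⟩ := hext ξ (fun η => F η) (fun η η' hlt => (ih η' η'.2).1 η hlt)
        (fun η => (ih η η.2).2)
      rw [← hF] at h₁ h₂
      exact ⟨fun η hη => h₁ ⟨η, hη⟩, h₂⟩
  exact ⟨F, fun η ξ hlt => (key ξ).1 η hlt, fun ξ => (key ξ).2⟩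

/-- `q` extends `p`, where a pair `(f, β)` stands for the restriction of `f` below `β`. -/
def Extends {I : Set Ordinal.{u}} {X : I → Type v} (p q : (∀ α, X α) × Ordinal.{u}) : Prop :=
  p.2 ≤ q.2 ∧ ∀ α : I, (α : Ordinal) < p.2 → q.1 α = p.1 α

/-- A coherent family of partial functions has a common extension, equal to `g` elsewhere. -/
theorem exists_glue {I : Set Ordinal.{u}} {X : I → Type v} {J : Type*} [LinearOrder J]
    (s : J → (∀ α, X α) × Ordinal.{u}) (hs : ∀ i j, i < j → Extends (s i) (s j))
    (g : ∀ α, X α) :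
    ∃ f : ∀ α, X α, (∀ i, ∀ α : I, (α : Ordinal) < (s i).2 → f α = (s i).1 α) ∧
      ∀ α : I, (∀ i, ¬ (α : Ordinal) < (s i).2) → f α = g α := by
  classical
  refine ⟨fun α => if h : ∃ i, (α : Ordinal) < (s i).2 then (s h.choose).1 α else g α,
    fun i α hα => ?_, fun α hα => dif_neg (by simpa using hα)⟩
  have h : ∃ i, (α : Ordinal) < (s i).2 := ⟨i, hα⟩
  have hc := h.choose_spec
  simp only [dif_pos h]
  rcases lt_trichotomy h.choose i with hlt | heq | hlt
  · exact ((hs _ _ hlt).2 α hc).symm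
  · rw [heq]
  · exact (hs _ _ hlt).2 α hα

section BoundedTopology

variable {X : Set.Iio (Cardinal.aleph 1).ord → Type v}

theorem isOpen_boundedTopology_cylinder (g : ∀ α, X α) {β : Ordinal}
    (hβ : β < (Cardinal.aleph 1).ord) :
    IsOpen[boundedTopology X] {f | ∀ α : Set.Iio (Cardinal.aleph 1).ord,
      (α : Ordinal) < β → f α = g α} :=
  TopologicalSpace.isOpen_generateFrom_of_mem ⟨g, β, hβ, rfl⟩

theorem exists_cylinder_subset_of_isOpen {U : Set (∀ α, X α)}
    (hU : IsOpen[boundedTopology X] U) {f : ∀ α, X α} (hf : f ∈ U) :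
    ∃ β < (Cardinal.aleph 1).ord, {h : ∀ α, X α | ∀ α : Set.Iio (Cardinal.aleph 1).ord,
      (α : Ordinal) < β → h α = f α} ⊆ U := by
  induction hU with
  | basic U hU =>
    obtain ⟨g, β, hβ, rfl⟩ := hU
    exact ⟨β, hβ, fun h hh α hα => (hh α hα).trans (hf α hα)⟩
  | univ => exact ⟨0, by simp [Ordinal.omega_pos], subset_univ _⟩
  | inter U V _ _ ihU ihV =>
    obtain ⟨β, hβ, hβU⟩ := ihU hf.1
    obtain ⟨γ, hγ, hγV⟩ := ihV hf.2
    exact ⟨max β γ, max_lt hβ hγ, fun h hh =>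
      ⟨hβU fun α hα => hh α (lt_max_of_lt_left hα),
        hγV fun α hα => hh α (lt_max_of_lt_right hα)⟩⟩
  | sUnion S _ ih =>
    obtain ⟨U, hUS, hfU⟩ := hf
    obtain ⟨β, hβ, hβU⟩ := ih U hUS hfU
    exact ⟨β, hβ, hβU.trans (subset_sUnion_of_mem hUS)⟩

theorem exists_cylinder_subset_of_dense {U : Set (∀ α, X α)}
    (hU : IsOpen[boundedTopology X] U) (hd : @Dense _ (boundedTopology X) U)
    (f : ∀ α, X α) {β : Ordinal} (hβ : β < (Cardinal.aleph 1).ord) :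
    ∃ q : (∀ α, X α) × Ordinal, Extends (f, β) q ∧ q.2 < (Cardinal.aleph 1).ord ∧
      {h : ∀ α, X α | ∀ α : Set.Iio (Cardinal.aleph 1).ord,
        (α : Ordinal) < q.2 → h α = q.1 α} ⊆ U := by
  let _ := boundedTopology X
  obtain ⟨g, hgf, hgU⟩ := hd.inter_open_nonempty _ (isOpen_boundedTopology_cylinder f hβ)
    ⟨f, fun _ _ => rfl⟩
  obtain ⟨γ, hγ, hγU⟩ := exists_cylinder_subset_of_isOpen hU hgU
  exact ⟨(g, max β γ), ⟨le_max_left _ _, hgf⟩, max_lt hβ hγ,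
    fun h hh => hγU fun α hα => hh α (lt_max_of_lt_right hα)⟩

end BoundedTopology

theorem countable_Iio_of_lt_ord_aleph_one {ξ : Ordinal} (hξ : ξ < (Cardinal.aleph 1).ord) :
    (Iio ξ).Countable := by
  rw [← Cardinal.le_aleph0_iff_set_countable, Cardinal.mk_Iio_ordinal, Cardinal.lift_le_aleph0,
    ← Cardinal.lt_aleph_one_iff]
  exact Cardinal.lt_ord.1 hξ

theorem iSup_lt_ord_aleph_one {J : Type*} [Countable J] {f : J → Ordinal}
    (hf : ∀ i, f i < (Cardinal.aleph 1).ord) : (⨆ i, f i) < (Cardinal.aleph 1).ord := by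
  rw [Cardinal.ord_aleph] at hf ⊢
  exact Ordinal.iSup_lt_omega_one hf

theorem stmt15 (X : Set.Iio (Cardinal.aleph 1).ord → Type v)
    (hX : ∀ α, Nontrivial (X α))
    (A : Set.Iio (Cardinal.aleph 1).ord → Set (∀ α, X α))
    (hopen : ∀ ξ, IsOpen[boundedTopology X] (A ξ))
    (hdense : ∀ ξ, @Dense _ (boundedTopology X) (A ξ)) :
    @Dense _ (boundedTopology X) (⋂ ξ, A ξ) := by
  let _ := boundedTopology X
  rw [dense_iff_inter_open]
  rintro W hW ⟨g, hg⟩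
  obtain ⟨β, hβ, hβW⟩ := exists_cylinder_subset_of_isOpen hW hg
  obtain ⟨F, hF, hgood⟩ := exists_seq_of_extend (ι := Set.Iio (Cardinal.aleph 1).ord)
    (Extends (X := X)) (fun ξ q => Extends (g, β) q ∧ q.2 < (Cardinal.aleph 1).ord ∧
      {h : ∀ α, X α | ∀ α : Set.Iio (Cardinal.aleph 1).ord,
        (α : Ordinal) < q.2 → h α = q.1 α} ⊆ A ξ) (by
    intro ξ s hs hsgood
    obtain ⟨f, hf, hfg⟩ := exists_glue s hs g
    have hcount : Countable (Iio ξ) :=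
      ((countable_Iio_of_lt_ord_aleph_one ξ.2).preimage Subtype.val_injective).to_subtype
    have hsup : (⨆ η, (s η).2) < (Cardinal.aleph 1).ord :=
      iSup_lt_ord_aleph_one fun η => (hsgood η).2.1
    obtain ⟨q, ⟨hle, hq⟩, hqlt, hqA⟩ := exists_cylinder_subset_of_dense (hopen ξ) (hdense ξ) f
      (max_lt hβ hsup)
    have hle' : ∀ η, (s η).2 ≤ max β (⨆ η, (s η).2) := fun η =>
      (Ordinal.le_iSup (fun η => (s η).2) η).trans (le_max_right _ _)
    refine ⟨q, fun η => ⟨(hle' η).trans hle, fun α hα => ?_⟩,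
      ⟨(le_max_left _ _).trans hle, fun α hα => ?_⟩, hqlt, hqA⟩
    · exact (hq α (hα.trans_le (hle' η))).trans (hf η α hα)
    · refine (hq α (lt_max_of_lt_left hα)).trans ?_
      by_cases hη : ∃ η, (α : Ordinal) < (s η).2
      · obtain ⟨η, hη⟩ := hη
        exact (hf η α hη).trans ((hsgood η).1.2 α hα)
      · exact hfg α (not_exists.1 hη))
  obtain ⟨f, hf, -⟩ := exists_glue F hF g
  refine ⟨f, hβW fun α hα => ?_, mem_iInter.2 fun ξ => (hgood ξ).2.2 fun α hα => hf ξ α hα⟩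
  obtain ⟨hle, hext⟩ := (hgood ⟨0, by simp [Ordinal.omega_pos]⟩).1
  exact (hf _ α (hα.trans_le hle)).trans (hext α hα)
end

section
/- Let T be the tree consisting of all functions f : β → 2 with β ≤ ω₁, together with, for each f : ω₁ → 2, the single extension f⌢⟨0⟩ of length ω₁ + 1, ordered by end-extension, and endowed with the coarse wedge topology. Then T has a retractional skeleton. -/
open Cardinal Ordinal Filter Set Topology

universe u v

/-- The ordinal `ω₁`. -/
noncomputable def omega1 : Ordinal.{0} := (Cardinal.aleph 1).ord

/-- The tree of all functions `f : β → 2` with `β ≤ ω₁`, together with, for each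
`f : ω₁ → 2`, the single extension `f⌢⟨0⟩` of length `ω₁ + 1`.  An element is coded
as a pair `(β, f)` with `β ≤ ω₁ + 1` and `f : Iio β → Bool`, where the value at the
coordinate `ω₁` (if present) is `false`. -/
def TreeEx : Type 1 :=
  {p : (β : Ordinal.{0}) × (Set.Iio β → Bool) //
    p.1 ≤ omega1 + 1 ∧ ∀ h : omega1 < p.1, p.2 ⟨omega1, h⟩ = false}

/-- `TreeEx` is ordered by end-extension. -/
instance : PartialOrder TreeEx where
  le p q := p.1.1 ≤ q.1.1 ∧
    ∀ (α : Ordinal) (h1 : α < p.1.1) (h2 : α < q.1.1), p.1.2 ⟨α, h1⟩ = q.1.2 ⟨α, h2⟩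
  le_refl p := ⟨le_rfl, fun _ _ _ => rfl⟩
  le_trans p q r hpq hqr := ⟨hpq.1.trans hqr.1, fun α h1 h2 =>
    (hpq.2 α h1 (h1.trans_le hpq.1)).trans (hqr.2 α (h1.trans_le hpq.1) h2)⟩
  le_antisymm p q hpq hqp := by
    obtain ⟨⟨β, f⟩, hp⟩ := p
    obtain ⟨⟨γ, g⟩, hq⟩ := q
    have hβγ : β = γ := le_antisymm hpq.1 hqp.1
    subst hβγ
    have hfg : f = g := funext fun x => hpq.2 x.1 x.2 x.2
    subst hfg
    rfl

/-- `TreeEx` carries the coarse wedge topology. -/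
instance : TopologicalSpace TreeEx := coarseWedge TreeEx


namespace TreeEx

/-- The length of the sequence `x`. -/
noncomputable def len (x : TreeEx) : Ordinal.{0} := x.1.1

theorem le_def {x y : TreeEx} : x ≤ y ↔ len x ≤ len y ∧
    ∀ (α : Ordinal) (h1 : α < len x) (h2 : α < len y), x.1.2 ⟨α, h1⟩ = y.1.2 ⟨α, h2⟩ :=
  Iff.rfl

theorem len_mono {x y : TreeEx} (h : x ≤ y) : len x ≤ len y := h.1

theorem le_of_len_le {x y z : TreeEx} (hx : x ≤ z) (hy : y ≤ z) (h : len x ≤ len y) : x ≤ y :=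
  ⟨h, fun α h1 h2 => (hx.2 α h1 (h1.trans_le hx.1)).trans (hy.2 α h2 (h2.trans_le hy.1)).symm⟩

theorem le_or_le_of_le {x y z : TreeEx} (hx : x ≤ z) (hy : y ≤ z) : x ≤ y ∨ y ≤ x :=
  (le_total (len x) (len y)).imp (le_of_len_le hx hy) (le_of_len_le hy hx)

theorem eq_of_len_eq {x y z : TreeEx} (hx : x ≤ z) (hy : y ≤ z) (h : len x = len y) : x = y :=
  le_antisymm (le_of_len_le hx hy h.le) (le_of_len_le hy hx h.ge)

/-- The initial segment of `x` of length `α`. -/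
noncomputable def restrict (x : TreeEx) (α : Ordinal) (h : α ≤ len x) : TreeEx :=
  ⟨⟨α, fun i => x.1.2 ⟨i.1, i.2.trans_le h⟩⟩, h.trans x.2.1, fun hα => x.2.2 (hα.trans_le h)⟩

theorem restrict_le (x : TreeEx) (α : Ordinal) (h : α ≤ len x) : x.restrict α h ≤ x :=
  ⟨h, fun _ _ _ => rfl⟩

/-- The strict predecessors of `x` correspond to the ordinals below its length. -/
noncomputable def predecessorsIso (x : TreeEx) :
    ((· < ·) : {y : TreeEx // y < x} → {y : TreeEx // y < x} → Prop) ≃r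
      ((· < ·) : Set.Iio (len x) → Set.Iio (len x) → Prop) where
  toFun y := ⟨len y.1, lt_of_le_of_ne (len_mono y.2.le) fun h =>
    y.2.ne (eq_of_len_eq y.2.le le_rfl h)⟩
  invFun α := ⟨x.restrict α.1 α.2.le, lt_of_le_of_ne (restrict_le x _ _) fun h =>
    α.2.ne (congrArg len h)⟩
  left_inv y := Subtype.ext (eq_of_len_eq (restrict_le x _ (len_mono y.2.le)) y.2.le rfl)
  right_inv _ := rfl
  map_rel_iff' {y z} := by
    change len y.1 < len z.1 ↔ y.1 < z.1
    refine ⟨fun h => lt_of_le_of_ne (le_of_len_le y.2.le z.2.le h.le) fun e => h.ne (e ▸ rfl),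
      fun h => lt_of_le_of_ne (len_mono h.le) fun e => h.ne (eq_of_len_eq y.2.le z.2.le e)⟩

theorem htx_eq (x : TreeEx) : htx x = Ordinal.lift.{1} (len x) := by
  have hw : IsWellOrder {y : TreeEx // y < x} (· < ·) :=
    x.predecessorsIso.toRelEmbedding.isWellOrder
  rw [htx, dif_pos hw, ← Ordinal.type_lt_Iio]
  exact x.predecessorsIso.ordinalType_congr

theorem succLevel_iff {x : TreeEx} : SuccLevel x ↔ ∃ γ, len x = γ + 1 := by
  simp only [SuccLevel, htx_eq]
  constructor
  · rintro ⟨β, h⟩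
    obtain ⟨γ, rfl⟩ := Ordinal.mem_range_lift_of_le (h ▸ le_self_add : β ≤ Ordinal.lift.{1} (len x))
    exact ⟨γ, by rwa [← Ordinal.lift_add_one, Ordinal.lift_inj] at h⟩
  · rintro ⟨γ, h⟩
    exact ⟨Ordinal.lift.{1} γ, by rw [h, Ordinal.lift_add_one]⟩

theorem succLevel_restrict (x : TreeEx) (γ : Ordinal) (h : γ + 1 ≤ len x) :
    SuccLevel (x.restrict (γ + 1) h) :=
  succLevel_iff.2 ⟨γ, rfl⟩

theorem le_of_isMin {t : TreeEx} (ht : IsMin t) (x : TreeEx) : t ≤ x := by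
  have h0 : len t = 0 := le_antisymm (len_mono (ht (restrict_le t 0 zero_le))) zero_le
  exact le_def.2 ⟨h0 ▸ zero_le, fun α h1 => absurd (h0 ▸ h1) not_lt_zero⟩

theorem le_of_forall_succLevel {x y : TreeEx}
    (h : ∀ t, SuccLevel t → t ≤ x → t ≤ y) : x ≤ y := by
  have key (γ) (hγ : γ < len x) : x.restrict (γ + 1) (Order.add_one_le_of_lt hγ) ≤ y :=
    h _ (succLevel_restrict ..) (restrict_le ..)
  exact le_def.2 ⟨le_of_forall_lt fun γ hγ => Order.add_one_le_iff.1 (len_mono (key γ hγ)),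
    fun α h1 h2 => (key α h1).2 α (lt_add_one α) h2⟩

theorem eq_of_forall_succLevel {x y : TreeEx}
    (h : ∀ t, SuccLevel t → (t ≤ x ↔ t ≤ y)) : x = y :=
  le_antisymm (le_of_forall_succLevel fun t ht => (h t ht).1)
    (le_of_forall_succLevel fun t ht => (h t ht).2)

/-- Every chain has a union. -/
theorem exists_forall_le_iff {C : Set TreeEx} (hC : IsChain (· ≤ ·) C) :
    ∃ x, ∀ t, SuccLevel t → (t ≤ x ↔ ∃ a ∈ C, t ≤ a) := by
  have hbound : omega1 + 1 ∈ upperBounds (len '' C) := by rintro _ ⟨c, -, rfl⟩; exact c.2.1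
  have hbdd : BddAbove (len '' C) := ⟨_, hbound⟩
  have hlt {α} (h : α < sSup (len '' C)) : ∃ c ∈ C, α < len c := by
    have hne : (len '' C).Nonempty := by
      by_contra hne
      rw [Set.not_nonempty_iff_eq_empty.1 hne, csSup_empty] at h
      exact not_lt_bot h
    obtain ⟨_, ⟨c, hc, rfl⟩, h⟩ := exists_lt_of_lt_csSup hne h
    exact ⟨c, hc, h⟩
  let f (i : Set.Iio (sSup (len '' C))) : Bool :=
    (hlt i.2).choose.1.2 ⟨i.1, (hlt i.2).choose_spec.2⟩
  let x : TreeEx := ⟨⟨sSup (len '' C), f⟩, csSup_le' hbound,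
    fun h => (hlt h).choose.2.2 (hlt h).choose_spec.2⟩
  have hCx (c) (hc : c ∈ C) : c ≤ x := by
    refine le_def.2 ⟨le_csSup hbdd ⟨c, hc, rfl⟩, fun α h1 h2 => ?_⟩
    have hd := (hlt h2).choose_spec
    rcases hC.total hc hd.1 with h | h
    · exact h.2 α h1 hd.2
    · exact (h.2 α hd.2 h1).symm
  refine ⟨x, fun t ht => ⟨fun h => ?_, fun ⟨a, ha, h⟩ => h.trans (hCx a ha)⟩⟩
  obtain ⟨γ, hγ⟩ := succLevel_iff.1 ht
  obtain ⟨c, hc, hcγ⟩ := hlt (Order.add_one_le_iff.1 (hγ ▸ len_mono h) : γ < sSup (len '' C))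
  exact ⟨c, hc, le_of_len_le h (hCx c hc) (hγ ▸ Order.add_one_le_of_lt hcγ)⟩

theorem isChain_setOf_le (A : Set TreeEx) (x : TreeEx) :
    IsChain (· ≤ ·) {a | a ∈ A ∧ a ≤ x} :=
  fun _ ha _ hb _ => le_or_le_of_le ha.2 hb.2

/-- The union of the members of `A` below `x`. -/
noncomputable def retract (A : Set TreeEx) (x : TreeEx) : TreeEx :=
  (exists_forall_le_iff (isChain_setOf_le A x)).choose

theorem le_retract {A : Set TreeEx} {x t : TreeEx} (ht : SuccLevel t) :
    t ≤ retract A x ↔ ∃ a ∈ A, t ≤ a ∧ a ≤ x := by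
  rw [retract, (exists_forall_le_iff (isChain_setOf_le A x)).choose_spec t ht]
  simp only [Set.mem_ofPred_eq, and_assoc, and_comm (a := _ ≤ x)]

theorem retract_retract_of_subset {A B : Set TreeEx} (hA : ∀ a ∈ A, SuccLevel a) (h : A ⊆ B)
    (x : TreeEx) : retract A (retract B x) = retract A x ∧ retract B (retract A x) = retract A x := by
  constructor <;> refine eq_of_forall_succLevel fun t ht => ?_ <;> simp only [le_retract ht]
  · constructor
    · rintro ⟨a, ha, hta, hax⟩
      obtain ⟨b, -, hab, hbx⟩ := (le_retract (hA a ha)).1 hax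
      exact ⟨a, ha, hta, hab.trans hbx⟩
    · rintro ⟨a, ha, hta, hax⟩
      exact ⟨a, ha, hta, (le_retract (hA a ha)).2 ⟨a, h ha, le_rfl, hax⟩⟩
  · constructor
    · rintro ⟨b, -, htb, hbx⟩
      exact (le_retract ht).1 (htb.trans hbx)
    · rintro ⟨a, ha, hta, hax⟩
      exact ⟨a, h ha, hta, (le_retract (hA a ha)).2 ⟨a, ha, le_rfl, hax⟩⟩

theorem isOpen_Vset {t : TreeEx} (ht : SuccLevel t) : IsOpen (Vset t) :=
  TopologicalSpace.isOpen_generateFrom_of_mem ⟨t, Or.inr ht, Or.inl rfl⟩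

theorem isClopen_Vset {t : TreeEx} (ht : SuccLevel t) : IsClopen (Vset t) :=
  ⟨⟨TopologicalSpace.isOpen_generateFrom_of_mem ⟨t, Or.inr ht, Or.inr rfl⟩⟩, isOpen_Vset ht⟩

theorem tendsto_of_forall_succLevel {ι : Type*} {l : Filter ι} {f : ι → TreeEx} {x : TreeEx}
    (h : ∀ t, SuccLevel t → t ≤ x → ∀ᶠ i in l, t ≤ f i)
    (h' : ∀ t, SuccLevel t → ¬ t ≤ x → ∀ᶠ i in l, ¬ t ≤ f i) : Tendsto f l (𝓝 x) := by
  refine TopologicalSpace.tendsto_nhds_generateFrom_iff.2 ?_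
  rintro _ ⟨t, hmin | ht, rfl | rfl⟩ hx
  · exact Eventually.of_forall fun i => le_of_isMin hmin _
  · exact absurd (le_of_isMin hmin x) hx
  · exact h t ht hx
  · exact h' t ht hx

theorem continuous_of_isClopen_preimage {f : TreeEx → TreeEx}
    (h : ∀ t, SuccLevel t → IsClopen (f ⁻¹' Vset t)) : Continuous f :=
  continuous_iff_continuousAt.2 fun _ => tendsto_of_forall_succLevel
    (fun t ht hx => (h t ht).isOpen.mem_nhds hx)
    (fun t ht hx => (h t ht).compl.isOpen.mem_nhds hx)

instance : CompactSpace TreeEx := by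
  refine ⟨isCompact_iff_ultrafilter_le_nhds.2 fun F _ => ?_⟩
  let C : Set TreeEx := {t | SuccLevel t ∧ Vset t ∈ F}
  have hC : IsChain (· ≤ ·) C := fun s hs t ht _ =>
    have ⟨_, h1, h2⟩ := F.nonempty_of_mem (inter_mem hs.2 ht.2)
    le_or_le_of_le h1 h2
  obtain ⟨x, hx⟩ := exists_forall_le_iff hC
  refine ⟨x, mem_univ x, tendsto_of_forall_succLevel (f := id) (fun t ht h => ?_) fun t ht h => ?_⟩
  · obtain ⟨a, ha, hta⟩ := (hx t ht).1 h
    exact mem_of_superset ha.2 fun y hy => hta.trans hy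
  · exact Ultrafilter.compl_mem_iff_notMem.2 fun hF => h ((hx t ht).2 ⟨t, ⟨ht, hF⟩, le_rfl⟩)

/-- The traces of a point on a set of nodes. -/
noncomputable def trace (A : Set TreeEx) (x : TreeEx) (a : A) : Bool := (Vset a.1).boolIndicator x

theorem continuous_trace {A : Set TreeEx} (hA : ∀ a ∈ A, SuccLevel a) : Continuous (trace A) :=
  continuous_pi fun a => (continuous_boolIndicator_iff_isClopen _).2 (isClopen_Vset (hA a a.2))

theorem le_iff_of_trace_eq {A : Set TreeEx} {x y : TreeEx} (h : trace A x = trace A y)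
    {a : TreeEx} (ha : a ∈ A) : a ≤ x ↔ a ≤ y :=
  ((Vset a).mem_iff_boolIndicator x).trans <| (Eq.congr_left (congrFun h ⟨a, ha⟩)).trans
    ((Vset a).mem_iff_boolIndicator y).symm

instance : T2Space TreeEx :=
  T2Space.of_injective_continuous (f := trace {t | SuccLevel t})
    (fun _ _ h => eq_of_forall_succLevel fun _ ht => le_iff_of_trace_eq h ht)
    (continuous_trace fun _ h => h)

/-- The index set of the skeleton: countable sets of successor-level nodes containing the common
successor-level predecessors of any two incomparable members. -/
def IsIndex (A : Set TreeEx) : Prop :=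
  A.Countable ∧ (∀ a ∈ A, SuccLevel a) ∧
    ∀ a ∈ A, ∀ b ∈ A, ¬ a ≤ b → ¬ b ≤ a → ∀ t, SuccLevel t → t ≤ a → t ≤ b → t ∈ A

theorem continuous_retract {A : Set TreeEx} (hA : IsIndex A) : Continuous (retract A) := by
  refine continuous_of_isClopen_preimage fun t ht => ?_
  by_cases hne : {a | a ∈ A ∧ t ≤ a}.Nonempty
  · obtain ⟨m, ⟨hmA, htm⟩, hm⟩ := exists_minimalFor_of_wellFoundedLT _ len hne
    have hle (b) (hb : b ∈ A) (htb : t ≤ b) : m ≤ b := by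
      by_contra hmb
      by_cases hbm : b ≤ m
      · exact hmb (le_of_len_le le_rfl hbm (hm ⟨hb, htb⟩ (len_mono hbm)))
      · have htA := hA.2.2 m hmA b hb hmb hbm t ht htm htb
        exact hmb ((le_of_len_le le_rfl htm (hm ⟨htA, le_rfl⟩ (len_mono htm))).trans htb)
    convert isClopen_Vset (hA.2.1 m hmA) using 1
    ext x
    exact (le_retract ht).trans ⟨fun ⟨b, hb, htb, hbx⟩ => (hle b hb htb).trans hbx,
      fun h => ⟨m, hmA, htm, h⟩⟩
  · convert isClopen_empty using 1
    ext x
    exact ⟨fun h => have ⟨a, ha, hta, _⟩ := (le_retract ht).1 h; hne ⟨a, ha, hta⟩, False.elim⟩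

theorem metrizableSpace_range_retract {A : Set TreeEx} (hA : IsIndex A) :
    TopologicalSpace.MetrizableSpace (Set.range (retract A)) := by
  have : CompactSpace (Set.range (retract A)) :=
    isCompact_iff_compactSpace.1 (isCompact_range (continuous_retract hA))
  have : Countable A := hA.1.to_subtype
  have hinj : Function.Injective fun x : Set.range (retract A) => trace A x.1 := by
    rintro ⟨_, x, rfl⟩ ⟨_, y, rfl⟩ h
    refine Subtype.ext ?_
    change retract A x = retract A y
    rw [← (retract_retract_of_subset hA.2.1 subset_rfl x).1,
      ← (retract_retract_of_subset hA.2.1 subset_rfl y).1]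
    refine eq_of_forall_succLevel fun t ht => ?_
    simp only [le_retract ht]
    exact exists_congr fun a => and_congr_right fun ha =>
      and_congr_right fun _ => le_iff_of_trace_eq h ha
  exact (((continuous_trace hA.2.1).comp continuous_subtype_val).isClosedEmbedding
    hinj).isEmbedding.metrizableSpace

theorem countable_Iic_of_lt_omega1 {α : Ordinal.{0}} (h : α < omega1) : (Set.Iic α).Countable := by
  rw [omega1, Cardinal.lt_ord, ← Cardinal.succ_aleph0, Order.lt_succ_iff] at h
  have : (Set.Iio α).Countable := by
    rw [← Cardinal.le_aleph0_iff_set_countable, Cardinal.mk_Iio_ordinal]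
    rwa [← Cardinal.lift_aleph0.{1, 0}, Cardinal.lift_le]
  rw [← Set.Iio_insert]
  exact this.insert α

theorem countable_setOf_le_of_incomparable {a b : TreeEx} (hab : ¬ a ≤ b) (hba : ¬ b ≤ a) :
    {t | t ≤ a ∧ t ≤ b}.Countable := by
  wlog hlen : len a ≤ len b generalizing a b
  · simpa only [and_comm] using this hba hab (le_of_not_ge hlen)
  simp only [le_def (x := a), hlen, true_and, not_forall] at hab
  obtain ⟨α, h1, h2, hne⟩ := hab
  have hα : α < omega1 := by
    refine lt_of_le_of_ne (Order.le_of_lt_add_one (h1.trans_le a.2.1)) ?_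
    rintro rfl
    exact hne ((a.2.2 h1).trans (b.2.2 h2).symm)
  refine Set.MapsTo.countable_of_injOn (f := len) (t := Set.Iic α) ?_
    (fun s hs t ht h => eq_of_len_eq hs.1 ht.1 h) (countable_Iic_of_lt_omega1 hα)
  intro t ht
  by_contra hlt
  have hlt : α < len t := not_le.1 hlt
  exact hne ((ht.1.2 α hlt h1).symm.trans (ht.2.2 α hlt h2))

theorem exists_isIndex_superset {B : Set TreeEx} (hB : B.Countable) (hs : ∀ b ∈ B, SuccLevel b) :
    ∃ A, IsIndex A ∧ B ⊆ A := by
  let D (a b : TreeEx) : Set TreeEx := {t | SuccLevel t ∧ (¬ a ≤ b ∧ ¬ b ≤ a) ∧ t ≤ a ∧ t ≤ b}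
  have hD (a b) : (D a b).Countable := by
    by_cases h : ¬ a ≤ b ∧ ¬ b ≤ a
    · exact (countable_setOf_le_of_incomparable h.1 h.2).mono fun t ht => ht.2.2
    · exact Set.countable_empty.mono fun t ht => h ht.2.1
  refine ⟨B ∪ ⋃ a ∈ B, ⋃ b ∈ B, D a b,
    ⟨hB.union (hB.biUnion fun a _ => hB.biUnion fun b _ => hD a b), ?_, ?_⟩,
    Set.subset_union_left⟩
  · rintro t (ht | ht)
    · exact hs t ht
    · simp only [Set.mem_iUnion] at ht
      obtain ⟨a, ha, b, hb, ht⟩ := ht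
      exact ht.1
  · have key (c) (hc : c ∈ ⋃ a ∈ B, ⋃ b ∈ B, D a b) (t) (ht : SuccLevel t) (htc : t ≤ c) :
        t ∈ ⋃ a ∈ B, ⋃ b ∈ B, D a b := by
      simp only [Set.mem_iUnion] at hc ⊢
      obtain ⟨a, ha, b, hb, hc⟩ := hc
      exact ⟨a, ha, b, hb, ht, hc.2.1, htc.trans hc.2.2.1, htc.trans hc.2.2.2⟩
    rintro a (ha | ha) b (hb | hb) hab hba t ht hta htb
    · exact Or.inr (Set.mem_biUnion ha (Set.mem_biUnion hb ⟨ht, ⟨hab, hba⟩, hta, htb⟩))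
    · exact Or.inr (key b hb t ht htb)
    all_goals exact Or.inr (key a ha t ht hta)

theorem isIndex_iUnion {A : ℕ → Set TreeEx} (hA : Monotone A) (h : ∀ n, IsIndex (A n)) :
    IsIndex (⋃ n, A n) := by
  refine ⟨Set.countable_iUnion fun n => (h n).1, ?_, ?_⟩
  · intro a ha
    obtain ⟨n, hn⟩ := Set.mem_iUnion.1 ha
    exact (h n).2.1 a hn
  · intro a ha b hb hab hba t ht hta htb
    obtain ⟨n, hn⟩ := Set.mem_iUnion.1 ha
    obtain ⟨m, hm⟩ := Set.mem_iUnion.1 hb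
    exact Set.mem_iUnion.2 ⟨max n m, (h _).2.2 a (hA (le_max_left n m) hn) b
      (hA (le_max_right n m) hm) hab hba t ht hta htb⟩

theorem tendsto_retract_iUnion {A : ℕ → Set TreeEx} (hA : Monotone A) (x : TreeEx) :
    Tendsto (fun n => retract (A n) x) atTop (𝓝 (retract (⋃ n, A n) x)) := by
  refine tendsto_of_forall_succLevel (fun t ht h => ?_) fun t ht h => ?_
  · obtain ⟨a, ha, hax⟩ := (le_retract ht).1 h
    obtain ⟨n, hn⟩ := Set.mem_iUnion.1 ha
    filter_upwards [eventually_ge_atTop n] with m hm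
    exact (le_retract ht).2 ⟨a, hA hm hn, hax⟩
  · refine Eventually.of_forall fun n hn => h ?_
    obtain ⟨a, ha, hax⟩ := (le_retract ht).1 hn
    exact (le_retract ht).2 ⟨a, Set.mem_iUnion.2 ⟨n, ha⟩, hax⟩

theorem tendsto_retract_atTop (x : TreeEx) :
    Tendsto (fun A : {A : Set TreeEx // IsIndex A} => retract A.1 x) atTop (𝓝 x) := by
  refine tendsto_of_forall_succLevel (fun t ht h => ?_) fun t ht h => ?_
  · obtain ⟨A, hA, htA⟩ := exists_isIndex_superset (Set.countable_singleton t)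
      (by rintro _ rfl; exact ht)
    filter_upwards [eventually_ge_atTop (⟨A, hA⟩ : {A : Set TreeEx // IsIndex A})] with B hB
    exact (le_retract ht).2 ⟨t, hB (htA rfl), le_rfl, h⟩
  · refine Eventually.of_forall fun A hA => h ?_
    obtain ⟨a, -, hta, hax⟩ := (le_retract ht).1 hA
    exact hta.trans hax

/-- The retractional skeleton of `TreeEx`. -/
noncomputable def skeleton : RetractionalSkeleton TreeEx where
  Γ := {A : Set TreeEx // IsIndex A}
  ne := have ⟨A, hA, _⟩ := exists_isIndex_superset Set.countable_empty fun _ h => h.elim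
    ⟨⟨A, hA⟩⟩
  directed A B :=
    have ⟨C, hC, h⟩ := exists_isIndex_superset (A.2.1.union B.2.1) fun b hb =>
      hb.elim (A.2.2.1 b) (B.2.2.1 b)
    ⟨⟨C, hC⟩, Set.subset_union_left.trans h, Set.subset_union_right.trans h⟩
  r A := retract A.1
  cont A := continuous_retract A.2
  retraction A x := (retract_retract_of_subset A.2.2.1 subset_rfl x).1
  compact_range A := isCompact_range (continuous_retract A.2)
  metrizable_range A := metrizableSpace_range_retract A.2
  comm A _ h := retract_retract_of_subset A.2.2.1 h
  seq_sup A hA := by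
    have hmono : Monotone fun n => (A n).1 := fun _ _ h => hA h
    refine ⟨⟨⋃ n, (A n).1, isIndex_iUnion hmono fun n => (A n).2⟩, ⟨?_, ?_⟩,
      tendsto_retract_iUnion hmono⟩
    · rintro _ ⟨n, rfl⟩
      exact Set.subset_iUnion (fun n => (A n).1) n
    · exact fun B hB => Set.iUnion_subset fun n => hB ⟨n, rfl⟩
  net_conv := tendsto_retract_atTop

end TreeEx

theorem stmt16 : Nonempty (RetractionalSkeleton TreeEx) :=
  ⟨TreeEx.skeleton⟩
end
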